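/- Let G be a commutative group, p a prime, and a, b ∈ G with orderOf a = p^m and orderOf b = p^{m'} where m' ≤ m. Let j and k be natural numbers such that p divides j and orderOf (a * (b^j)⁻¹) divides Nat.gcd j (p^k). Then orderOf a divides p^k. -/

import Mathlib

theorem stmt_2 {G : Type*} [CommGroup G] (p : ℕ) (hp : p.Prime) (a b : G)
    (m m' : ℕ) (ha : orderOf a = p ^ m) (hb : orderOf b = p ^ m') (hm : m' ≤ m)
    (j k : ℕ) (hpj : p ∣ j) (hdvd : orderOf (a * (b ^ j)⁻¹) ∣ Nat.gcd j (p ^ k)) :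
    orderOf a ∣ p ^ k := by
  rw [ha]
  by_contra hmk
  have hkm : k < m := by
    by_contra! h
    exact hmk (pow_dvd_pow p h)
  obtain ⟨n, rfl⟩ : ∃ n, m = n + 1 := ⟨m - 1, by omega⟩
  have hc : (a * (b ^ j)⁻¹) ^ p ^ n = 1 :=
    orderOf_dvd_iff_pow_eq_one.mp
      ((hdvd.trans (Nat.gcd_dvd_right _ _)).trans (pow_dvd_pow p (Nat.lt_succ_iff.mp hkm)))
  have hbj : (b ^ j) ^ p ^ n = 1 := by
    rw [← pow_mul, ← orderOf_dvd_iff_pow_eq_one, hb]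
    refine (pow_dvd_pow p hm).trans ?_
    rw [pow_succ']
    exact mul_dvd_mul_right hpj _
  rw [mul_pow, inv_pow, hbj, inv_one, mul_one, ← orderOf_dvd_iff_pow_eq_one, ha,
    Nat.pow_dvd_pow_iff_le_right hp.one_lt] at hc
  omega
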